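/- Let ξ be a T-number. Then liminf_{n→∞} ŵ_n(ξ)/n = 1. -/

import Mathlib

open Polynomial Filter

/-- Height of an integer polynomial: the maximum absolute value of its coefficients. -/
noncomputable def polyHeight (P : Polynomial ℤ) : ℝ :=
  ((P.support.sup fun i => (P.coeff i).natAbs : ℕ) : ℝ)

/-- `P` and `Q` have no common non-constant factor in `ℤ[X]`. -/
def CoprimePoly (P Q : Polynomial ℤ) : Prop :=
  ∀ d : Polynomial ℤ, d ∣ P → d ∣ Q → d.natDegree = 0

/-- The exponent `w_n(ξ)`. -/
noncomputable def wExp (n : ℕ) (ξ : ℝ) : EReal :=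
  sSup {x : EReal | ∃ w : ℝ, x = (w : EReal) ∧
    {P : Polynomial ℤ | P.natDegree ≤ n ∧ 0 < |Polynomial.aeval ξ P| ∧
      |Polynomial.aeval ξ P| ≤ (polyHeight P) ^ (-w)}.Infinite}

/-- The uniform exponent `ŵ_n(ξ)`. -/
noncomputable def whExp (n : ℕ) (ξ : ℝ) : EReal :=
  sSup {x : EReal | ∃ w : ℝ, x = (w : EReal) ∧
    ∀ᶠ H : ℝ in atTop, ∃ P : Polynomial ℤ, P.natDegree ≤ n ∧ polyHeight P ≤ H ∧
      0 < |Polynomial.aeval ξ P| ∧ |Polynomial.aeval ξ P| ≤ H ^ (-w)}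

/-- The exponent `w*_n(ξ)` of approximation by algebraic numbers of degree at most `n`;
the height of an algebraic number is the height of its irreducible defining polynomial. -/
noncomputable def wStarExp (n : ℕ) (ξ : ℝ) : EReal :=
  sSup {x : EReal | ∃ w : ℝ, x = (w : EReal) ∧
    {α : ℝ | ∃ P : Polynomial ℤ, Irreducible P ∧ Polynomial.aeval α P = 0 ∧
      P.natDegree ≤ n ∧ 0 < |ξ - α| ∧ |ξ - α| ≤ (polyHeight P) ^ (-w - 1)}.Infinite}

/-- The uniform exponent `ŵ*_n(ξ)`. -/
noncomputable def whStarExp (n : ℕ) (ξ : ℝ) : EReal :=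
  sSup {x : EReal | ∃ w : ℝ, x = (w : EReal) ∧
    ∀ᶠ H : ℝ in atTop, ∃ α : ℝ, ∃ P : Polynomial ℤ, Irreducible P ∧
      Polynomial.aeval α P = 0 ∧ P.natDegree ≤ n ∧ polyHeight P ≤ H ∧
      0 < |ξ - α| ∧ |ξ - α| ≤ (polyHeight P)⁻¹ * H ^ (-w)}

theorem abs_coeff_le_polyHeight (P : ℤ[X]) (i : ℕ) : |(P.coeff i : ℝ)| ≤ polyHeight P := by
  rw [← Int.cast_abs, Int.abs_eq_natAbs, Int.cast_natCast, polyHeight, Nat.cast_le]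
  by_cases hi : i ∈ P.support
  · exact Finset.le_sup (f := fun i => (P.coeff i).natAbs) hi
  · simp [notMem_support_iff.mp hi]

theorem polyHeight_le {P : ℤ[X]} {B : ℝ} (hB : 0 ≤ B) (h : ∀ i, |(P.coeff i : ℝ)| ≤ B) :
    polyHeight P ≤ B := by
  rw [polyHeight, ← Nat.le_floor_iff hB, Finset.sup_le_iff]
  intro i _
  rw [Nat.le_floor_iff hB]
  simpa [Nat.cast_natAbs] using h i

theorem one_le_polyHeight {P : ℤ[X]} (hP : P ≠ 0) : 1 ≤ polyHeight P := by
  refine le_trans ?_ (abs_coeff_le_polyHeight P P.natDegree)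
  exact_mod_cast Int.one_le_abs (leadingCoeff_ne_zero.mpr hP)

theorem mahlerMeasure_le_polyHeight {n : ℕ} {P : ℤ[X]} (hn : P.natDegree ≤ n) :
    (P.map (Int.castRingHom ℂ)).mahlerMeasure ≤ (n + 1) * polyHeight P := by
  refine (mahlerMeasure_le_sum_norm_coeff _).trans ?_
  rw [sum_over_range' _ (by simp) (n + 1)
    (Nat.lt_succ_of_le ((natDegree_map_le).trans hn))]
  refine (Finset.sum_le_card_nsmul _ _ (polyHeight P) fun i _ => ?_).trans (by simp)
  simpa using abs_coeff_le_polyHeight P i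

theorem polyHeight_le_mahlerMeasure {n : ℕ} {P : ℤ[X]} (hn : P.natDegree ≤ n) :
    polyHeight P ≤ 2 ^ n * (P.map (Int.castRingHom ℂ)).mahlerMeasure := by
  have h0 := mahlerMeasure_nonneg (P.map (Int.castRingHom ℂ))
  refine polyHeight_le (by positivity) fun i => ?_
  have := norm_coeff_le_choose_mul_mahlerMeasure i (P.map (Int.castRingHom ℂ))
  simp only [coeff_map, eq_intCast, Complex.norm_intCast] at this
  refine this.trans ?_
  gcongr
  have h1 := Nat.choose_le_two_pow (P.map (Int.castRingHom ℂ)).natDegree i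
  have h2 : 2 ^ (P.map (Int.castRingHom ℂ)).natDegree ≤ 2 ^ n :=
    Nat.pow_le_pow_right (by norm_num) (natDegree_map_le.trans hn)
  exact_mod_cast h1.trans h2

/-- Gelfond's inequality: heights are multiplicative up to a constant. -/
theorem polyHeight_mul_polyHeight_le {n : ℕ} {P Q : ℤ[X]} (hP : P.natDegree ≤ n)
    (hQ : Q.natDegree ≤ n) :
    polyHeight P * polyHeight Q ≤ 2 ^ n * 2 ^ n * (n + n + 1) * polyHeight (P * Q) := by
  have h := mahlerMeasure_le_polyHeight (natDegree_mul_le.trans (Nat.add_le_add hP hQ))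
  rw [Polynomial.map_mul, mahlerMeasure_mul] at h
  have h0 := mahlerMeasure_nonneg (P.map (Int.castRingHom ℂ))
  have h0' : 0 ≤ polyHeight Q := Nat.cast_nonneg _
  calc polyHeight P * polyHeight Q
      ≤ (2 ^ n * (P.map (Int.castRingHom ℂ)).mahlerMeasure) *
          (2 ^ n * (Q.map (Int.castRingHom ℂ)).mahlerMeasure) :=
        mul_le_mul (polyHeight_le_mahlerMeasure hP) (polyHeight_le_mahlerMeasure hQ) h0'
          (by positivity)
    _ = 2 ^ n * 2 ^ n * ((P.map (Int.castRingHom ℂ)).mahlerMeasure *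
          (Q.map (Int.castRingHom ℂ)).mahlerMeasure) := by ring
    _ ≤ 2 ^ n * 2 ^ n * (((n + n : ℕ) + 1) * polyHeight (P * Q)) := by gcongr
    _ = _ := by push_cast; ring

theorem finite_natDegree_le_polyHeight_le (n : ℕ) (B : ℝ) :
    {P : ℤ[X] | P.natDegree ≤ n ∧ polyHeight P ≤ B}.Finite := by
  refine (finite_mahlerMeasure_le n ((n + 1) * B).toNNReal).subset fun P hP => ?_
  refine ⟨hP.1, (mahlerMeasure_le_polyHeight hP.1).trans ?_⟩
  refine le_trans ?_ (Real.le_coe_toNNReal _)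
  gcongr
  exact hP.2

/-- A nonvanishing integer determinant whose rows are the coefficients of polynomials that are
small at `ξ` bounds this smallness from below. -/
theorem one_le_factorial_mul_of_linearIndependent (ξ : ℝ) {N : ℕ} (hN : 0 < N)
    (r : Fin N → ℤ[X]) (hdeg : ∀ i, (r i).natDegree < N) (b : Fin N → ℝ) (hb : ∀ i, 1 ≤ b i)
    (hrb : ∀ i, polyHeight (r i) ≤ b i) {η : ℝ} (hη : ∀ i, |aeval ξ (r i)| ≤ η)
    (hli : ∀ c : Fin N → ℤ, ∑ i, C (c i) * r i = 0 → c = 0) :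
    1 ≤ (N.factorial : ℝ) * (η * ∏ i, b i) := by
  set M : Matrix (Fin N) (Fin N) ℤ := Matrix.of fun i j => (r i).coeff j with hM
  have hdet : M.det ≠ 0 := by
    intro h0
    obtain ⟨v, hv0, hv⟩ := Matrix.exists_vecMul_eq_zero_iff.mpr h0
    refine hv0 (hli v (Polynomial.ext fun j => ?_))
    simp only [finsetSum_coeff, coeff_C_mul, coeff_zero]
    by_cases hj : j < N
    · simpa [Matrix.vecMul, dotProduct, hM] using congrFun hv ⟨j, hj⟩
    · refine Finset.sum_eq_zero fun i _ => ?_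
      rw [coeff_eq_zero_of_natDegree_lt (by have := hdeg i; omega), mul_zero]
  set A : Matrix (Fin N) (Fin N) ℝ := M.map (Int.castRingHom ℝ) with hA
  have hdetA : 1 ≤ |A.det| := by
    have : A.det = ((M.det : ℤ) : ℝ) := by
      rw [hA, ← RingHom.mapMatrix_apply, ← RingHom.map_det]; rfl
    rw [this]
    exact_mod_cast Int.one_le_abs hdet
  let z : Fin N := ⟨0, hN⟩
  have hcol := Matrix.det_updateCol_sum A z (fun i => ξ ^ (i : ℕ))
  have hval : (fun k => ∑ i : Fin N, ξ ^ (i : ℕ) • A k i) = fun k => aeval ξ (r k) := by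
    funext k
    rw [aeval_eq_sum_range' (hdeg k), ← Fin.sum_univ_eq_sum_range
      (fun i => (r k).coeff i • ξ ^ i)]
    refine Finset.sum_congr rfl fun i _ => ?_
    simp [hA, hM, mul_comm]
  rw [hval] at hcol
  have hz : ξ ^ (z : ℕ) • A.det = A.det := by simp [z]
  rw [hz] at hcol
  refine hdetA.trans ?_
  rw [← hcol, Matrix.det_apply]
  refine (Finset.abs_sum_le_sum_abs _ _).trans ?_
  refine (Finset.sum_le_card_nsmul _ _ (η * ∏ i, b i) fun σ _ => ?_).trans
    (by simp [Fintype.card_perm])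
  have hη0 : 0 ≤ η := (abs_nonneg _).trans (hη z)
  have habs : ∀ x : ℝ, |Equiv.Perm.sign σ • x| = |x| := fun x => by
    rcases Int.units_eq_one_or (Equiv.Perm.sign σ) with h | h <;> simp [h]
  rw [habs, Finset.abs_prod]
  calc ∏ i, |A.updateCol z (fun k => aeval ξ (r k)) (σ i) i|
      ≤ ∏ i, ((if i = z then η else 1) * b (σ i)) := by
        refine Finset.prod_le_prod (fun _ _ => abs_nonneg _) fun i _ => ?_
        by_cases hi : i = z
        · rw [hi]
          simpa using (hη (σ z)).trans (le_mul_of_one_le_right hη0 (hb (σ z)))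
        · simpa [Matrix.updateCol_ne hi, hi, hA, hM] using
            (abs_coeff_le_polyHeight (r (σ i)) i).trans (hrb _)
    _ = η * ∏ i, b i := by
        rw [Finset.prod_mul_distrib, Finset.prod_ite_eq' Finset.univ z (fun _ => η),
          Equiv.prod_comp σ b]
        simp

theorem one_le_factorial_mul_of_not_dvd (ξ : ℝ) {m : ℕ} (hm : 0 < m) {F Q : ℤ[X]} (hF : Prime F)
    (hFdeg : F.natDegree = m) (hQ : Q.natDegree ≤ m) (hFQ : ¬ F ∣ Q) {h H θ : ℝ} (hh : 1 ≤ h)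
    (hH : 1 ≤ H) (hFh : polyHeight F ≤ h) (hQH : polyHeight Q ≤ H) (hFθ : |aeval ξ F| ≤ θ)
    (hQθ : |aeval ξ Q| ≤ θ) :
    1 ≤ ((m + m).factorial : ℝ) * ((max 1 |ξ|) ^ m * θ * (h ^ m * H ^ m)) := by
  have hshift : ∀ (R : ℤ[X]) (i : Fin m), polyHeight (X ^ (i : ℕ) * R) ≤ polyHeight R := by
    intro R i
    refine polyHeight_le (Nat.cast_nonneg _) fun j => ?_
    rw [coeff_X_pow_mul']
    split_ifs
    · exact abs_coeff_le_polyHeight R _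
    · rw [Int.cast_zero, abs_zero]
      exact Nat.cast_nonneg _
  have hval : ∀ (R : ℤ[X]) (i : Fin m), |aeval ξ R| ≤ θ →
      |aeval ξ (X ^ (i : ℕ) * R)| ≤ (max 1 |ξ|) ^ m * θ := by
    intro R i hR
    rw [map_mul, abs_mul, map_pow, aeval_X, abs_pow]
    have h1 : |ξ| ^ (i : ℕ) ≤ (max 1 |ξ|) ^ m :=
      (pow_le_pow_left₀ (abs_nonneg _) (le_max_right _ _) _).trans
        (pow_le_pow_right₀ (le_max_left _ _) i.2.le)
    gcongr
  have key := one_le_factorial_mul_of_linearIndependent ξ (N := m + m) (by omega)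
    (Fin.append (fun i : Fin m => X ^ (i : ℕ) * F) (fun i : Fin m => X ^ (i : ℕ) * Q))
    (fun i => by
      refine Fin.addCases (fun i => ?_) (fun i => ?_) i
      · rw [Fin.append_left]
        refine natDegree_mul_le.trans_lt ?_
        rw [natDegree_X_pow]; omega
      · rw [Fin.append_right]
        refine natDegree_mul_le.trans_lt ?_
        rw [natDegree_X_pow]; omega)
    (Fin.append (fun _ : Fin m => h) (fun _ : Fin m => H))
    (fun i => by
      refine Fin.addCases (fun i => ?_) (fun i => ?_) i
      · rwa [Fin.append_left]
      · rwa [Fin.append_right])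
    (fun i => by
      refine Fin.addCases (fun i => ?_) (fun i => ?_) i
      · simpa only [Fin.append_left] using (hshift F i).trans hFh
      · simpa only [Fin.append_right] using (hshift Q i).trans hQH)
    (η := (max 1 |ξ|) ^ m * θ)
    (fun i => by
      refine Fin.addCases (fun i => ?_) (fun i => ?_) i
      · simpa only [Fin.append_left] using hval F i hFθ
      · simpa only [Fin.append_right] using hval Q i hQθ)
    (fun c hc => by
      have hcoeff : ∀ d : Fin m → ℤ, (∑ i, C (d i) * X ^ (i : ℕ)) = 0 → ∀ i, d i = 0 := by
        intro d hd i
        have := congrArg (fun R : ℤ[X] => R.coeff i) hd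
        simpa [finsetSum_coeff, coeff_X_pow, Fin.val_inj] using this
      have hsum : ∀ (d : Fin m → ℤ) (R : ℤ[X]), ∑ i, C (d i) * (X ^ (i : ℕ) * R) =
          (∑ i, C (d i) * X ^ (i : ℕ)) * R := by
        intro d R
        rw [Finset.sum_mul]
        exact Finset.sum_congr rfl fun i _ => (mul_assoc _ _ _).symm
      rw [Fin.sum_univ_add] at hc
      simp only [Fin.append_left, Fin.append_right] at hc
      rw [hsum (fun i => c (Fin.castAdd m i)), hsum (fun i => c (Fin.natAdd m i))] at hc
      set A := ∑ i, C (c (Fin.castAdd m i)) * X ^ (i : ℕ) with hA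
      set B := ∑ i, C (c (Fin.natAdd m i)) * X ^ (i : ℕ) with hB
      have hBdeg : B.natDegree < m := by
        refine lt_of_le_of_lt (natDegree_sum_le_of_forall_le (n := m - 1) _ _ fun i _ => ?_)
          (by omega)
        exact (natDegree_C_mul_X_pow_le _ _).trans (by have := i.2; omega)
      have hFB : F ∣ B * Q := ⟨-A, by linear_combination hc⟩
      have hB0 : B = 0 := by
        rcases hF.dvd_or_dvd hFB with h1 | h1
        · exact eq_zero_of_dvd_of_natDegree_lt h1 (by omega)
        · exact absurd h1 hFQ
      have hA0 : A = 0 := by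
        rw [hB0, zero_mul, add_zero] at hc
        exact (mul_eq_zero.mp hc).resolve_right hF.ne_zero
      funext i
      refine Fin.addCases (fun i => ?_) (fun i => ?_) i
      · exact hcoeff (fun i => c (Fin.castAdd m i)) hA0 i
      · exact hcoeff (fun i => c (Fin.natAdd m i)) hB0 i)
  simpa only [Fin.prod_univ_add, Fin.append_left, Fin.append_right, Finset.prod_const,
    Finset.card_univ, Fintype.card_fin] using key

/-- The polynomials counted in the definition of the exponent `wExp`. -/
def approxPoly (n : ℕ) (ξ w : ℝ) : Set ℤ[X] :=
  {P | P.natDegree ≤ n ∧ 0 < |aeval ξ P| ∧ |aeval ξ P| ≤ polyHeight P ^ (-w)}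

theorem ne_zero_of_abs_aeval_pos {ξ : ℝ} {P : ℤ[X]} (h : 0 < |aeval ξ P|) : P ≠ 0 := by
  rintro rfl
  simp at h

theorem infinite_approxPoly {n : ℕ} {ξ w : ℝ} (hw : (w : EReal) < wExp n ξ) :
    (approxPoly n ξ w).Infinite := by
  obtain ⟨_, ⟨w₁, rfl, hinf⟩, hlt⟩ := lt_sSup_iff.mp hw
  refine hinf.mono fun P hP => ⟨hP.1, hP.2.1, hP.2.2.trans ?_⟩
  exact Real.rpow_le_rpow_of_exponent_le (one_le_polyHeight (ne_zero_of_abs_aeval_pos hP.2.1))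
    (neg_le_neg (EReal.coe_lt_coe_iff.mp hlt).le)

theorem finite_approxPoly {n : ℕ} {ξ w : ℝ} (hw : wExp n ξ < w) : (approxPoly n ξ w).Finite := by
  by_contra hinf
  exact hw.not_ge (le_sSup ⟨w, rfl, hinf⟩)

theorem exists_mul_rpow_le_abs_aeval {n : ℕ} {ξ w : ℝ} (hξ : Transcendental ℤ ξ) (hw0 : 0 < w)
    (hw : wExp n ξ < w) :
    ∃ c : ℝ, 0 < c ∧ ∀ P : ℤ[X], P ≠ 0 → P.natDegree ≤ n →
      c * polyHeight P ^ (-w) ≤ |aeval ξ P| := by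
  obtain ⟨c, hc, hmin⟩ := Set.exists_min_image
    (insert 1 ((fun P : ℤ[X] => |aeval ξ P|) '' approxPoly n ξ w)) id
    (((finite_approxPoly hw).image _).insert _) ⟨1, Set.mem_insert _ _⟩
  have hc0 : 0 < c := by
    rcases hc with rfl | ⟨P, hP, rfl⟩
    · exact one_pos
    · exact hP.2.1
  refine ⟨c, hc0, fun P hP hdeg => ?_⟩
  have h1 := one_le_polyHeight hP
  by_cases hPS : P ∈ approxPoly n ξ w
  · refine le_trans ?_ (hmin _ (Set.mem_insert_of_mem _ ⟨P, hPS, rfl⟩))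
    exact mul_le_of_le_one_right hc0.le
      (Real.rpow_le_one_of_one_le_of_nonpos h1 (by linarith))
  · have hpos : 0 < |aeval ξ P| :=
      abs_pos.mpr fun h0 => hP (transcendental_iff.mp hξ P h0)
    have hlt : polyHeight P ^ (-w) < |aeval ξ P| := by
      by_contra! hle
      exact hPS ⟨hdeg, hpos, hle⟩
    refine le_trans ?_ hlt.le
    exact mul_le_of_le_one_left (by positivity) (hmin 1 (Set.mem_insert _ _))

theorem exists_irreducible_dvd_natDegree_pos {P : ℤ[X]} (hP : 0 < P.natDegree) :
    ∃ F : ℤ[X], Irreducible F ∧ F ∣ P ∧ 0 < F.natDegree := by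
  have hP0 : P ≠ 0 := by rintro rfl; simp at hP
  have hprim := isPrimitive_primPart P
  have hu : ¬ IsUnit P.primPart := fun hu => by
    have := natDegree_eq_zero_of_isUnit hu
    rw [natDegree_primPart] at this
    omega
  obtain ⟨F, hF, hdvd⟩ := WfDvdMonoid.exists_irreducible_factor hu hprim.ne_zero
  refine ⟨F, hF, hdvd.trans (primPart_dvd P), Nat.pos_of_ne_zero fun h0 => hF.not_isUnit ?_⟩
  rw [eq_C_of_natDegree_eq_zero h0] at hdvd ⊢
  exact isUnit_C.mpr (hprim _ hdvd)

theorem exists_irreducible_approximation {m : ℕ} (hm : 0 < m) {ξ w' w : ℝ}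
    (hξ : Transcendental ℤ ξ) (hw'0 : 0 < w') (hw'w : w' < w) (hw' : wExp (m - 1) ξ < w')
    (hw : w < wExp m ξ) (B : ℝ) :
    ∃ h : ℝ, B ≤ h ∧ ∃ F : ℤ[X], Irreducible F ∧ F.natDegree = m ∧ polyHeight F ≤ h ∧
      |aeval ξ F| ≤ h ^ (-w) := by
  obtain ⟨c, hc0, hc⟩ := exists_mul_rpow_le_abs_aeval hξ hw'0 hw'
  set K : ℝ := 2 ^ m * 2 ^ m * (m + m + 1) with hK
  have hKpos : 0 < K := by positivity
  obtain ⟨h₀, hh₀⟩ : ∃ h₀, ∀ h ≥ h₀, h ^ (-(w - w')) < c * c * K ^ (-w') :=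
    eventually_atTop.mp ((tendsto_rpow_neg_atTop (sub_pos.mpr hw'w)).eventually
      (gt_mem_nhds (by positivity)))
  obtain ⟨P, hPT, hPB⟩ := ((infinite_approxPoly hw).sdiff
    (finite_natDegree_le_polyHeight_le m (max B h₀))).nonempty
  have hPh : max B h₀ < polyHeight P := by
    by_contra! hle
    exact hPB ⟨hPT.1, hle⟩
  have hP0 := ne_zero_of_abs_aeval_pos hPT.2.1
  have hP1 := one_le_polyHeight hP0
  have hfactor : ∀ G Q : ℤ[X], P = G * Q → G.natDegree ≤ m - 1 → Q.natDegree ≤ m - 1 → False := by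
    rintro G Q hGQ hG hQ
    have hG0 : G ≠ 0 := by rintro rfl; simp [hP0] at hGQ
    have hQ0 : Q ≠ 0 := by rintro rfl; simp [hP0] at hGQ
    have hGh := one_le_polyHeight hG0
    have hQh := one_le_polyHeight hQ0
    have hgel := polyHeight_mul_polyHeight_le (hG.trans (Nat.sub_le _ _))
      (hQ.trans (Nat.sub_le _ _))
    rw [← hGQ] at hgel
    have h1 : c * c * K ^ (-w') * polyHeight P ^ (-w') ≤ |aeval ξ P| :=
      calc c * c * K ^ (-w') * polyHeight P ^ (-w')
          = c * c * (K * polyHeight P) ^ (-w') := by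
            rw [Real.mul_rpow hKpos.le (by linarith)]; ring
        _ ≤ c * c * (polyHeight G * polyHeight Q) ^ (-w') := by
            gcongr ?_ * ?_
            exact Real.rpow_le_rpow_of_nonpos (by positivity) hgel (by linarith)
        _ = (c * polyHeight G ^ (-w')) * (c * polyHeight Q ^ (-w')) := by
            rw [Real.mul_rpow (by linarith) (by linarith)]; ring
        _ ≤ |aeval ξ G| * |aeval ξ Q| :=
            mul_le_mul (hc G hG0 hG) (hc Q hQ0 hQ) (by positivity) (abs_nonneg _)
        _ = |aeval ξ P| := by rw [hGQ, map_mul, abs_mul]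
    have h2 := hh₀ _ ((le_max_right _ _).trans hPh.le)
    have h3 : polyHeight P ^ (-w) = polyHeight P ^ (-(w - w')) * polyHeight P ^ (-w') := by
      rw [← Real.rpow_add (by linarith)]; ring_nf
    have h4 : 0 < polyHeight P ^ (-w') := by positivity
    have h5 := hPT.2.2
    rw [h3] at h5
    exact absurd (h1.trans h5) (not_le.mpr (mul_lt_mul_of_pos_right h2 h4))
  have hPdeg : P.natDegree = m := by
    by_contra hne
    have := hPT.1
    exact hfactor P 1 (mul_one P).symm (by omega) (by simp)
  obtain ⟨F, hF, ⟨G, hFG⟩, hFpos⟩ := exists_irreducible_dvd_natDegree_pos (P := P) (by omega)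
  have hG0 : G ≠ 0 := by rintro rfl; simp [hP0] at hFG
  have hdeg : m = F.natDegree + G.natDegree := by
    rw [← hPdeg, hFG, natDegree_mul hF.ne_zero hG0]
  have hFm : F.natDegree = m := by
    by_contra hne
    exact hfactor F G hFG (by omega) (by omega)
  obtain ⟨g, rfl⟩ : ∃ g, G = C g := ⟨_, eq_C_of_natDegree_eq_zero (by omega)⟩
  have hg : (1 : ℝ) ≤ |(g : ℝ)| := by
    exact_mod_cast Int.one_le_abs (by rintro rfl; simp at hG0)
  refine ⟨polyHeight P, (le_max_left _ _).trans hPh.le, F, hF, hFm, ?_, ?_⟩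
  · refine polyHeight_le (by linarith) fun i => ?_
    refine le_trans ?_ (abs_coeff_le_polyHeight P i)
    rw [hFG, coeff_mul_C, Int.cast_mul, abs_mul]
    exact le_mul_of_one_le_right (abs_nonneg _) hg
  · refine le_trans ?_ hPT.2.2
    rw [hFG, map_mul, abs_mul, aeval_C]
    exact le_mul_of_one_le_right (abs_nonneg _) (by simpa using hg)

theorem exists_uniform_approximation {n : ℕ} {ξ v : ℝ} (hv : (v : EReal) < whExp n ξ) :
    ∃ H₀ : ℝ, ∀ H ≥ H₀, ∃ P : ℤ[X], P.natDegree ≤ n ∧ polyHeight P ≤ H ∧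
      0 < |aeval ξ P| ∧ |aeval ξ P| ≤ H ^ (-v) := by
  obtain ⟨_, ⟨w, rfl, hev⟩, hlt⟩ := lt_sSup_iff.mp hv
  refine eventually_atTop.mp ((hev.and (eventually_ge_atTop 1)).mono ?_)
  rintro H ⟨⟨P, h1, h2, h3, h4⟩, hH⟩
  exact ⟨P, h1, h2, h3, h4.trans (Real.rpow_le_rpow_of_exponent_le hH
    (neg_le_neg (EReal.coe_lt_coe_iff.mp hlt).le))⟩

/-- If `w_m(ξ)` is large and exceeds `w_{m-1}(ξ)`, then the uniform exponent is close to `m`. -/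
theorem whExp_le_of_lt_wExp {m : ℕ} (hm : 0 < m) {ξ v w' w : ℝ} (hξ : Transcendental ℤ ξ)
    (hw'0 : 0 < w') (hw'w : w' < w) (hw' : wExp (m - 1) ξ < w') (hw : w < wExp m ξ)
    (hv : (m : ℝ) < v) (hmw : (m : ℝ) < w * (1 - m / v)) : whExp m ξ ≤ v := by
  by_contra! hlt
  obtain ⟨H₀, hH₀⟩ := exists_uniform_approximation hlt
  have hm0 : (0 : ℝ) < m := by exact_mod_cast hm
  have hv0 : 0 < v := hm0.trans hv
  have hmv : (m : ℝ) / v < 1 := (div_lt_one hv0).mpr hv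
  have hw0 : 0 < w := hw'0.trans hw'w
  set s : ℝ := 1 - m / v with hs
  have hs0 : 0 < s := sub_pos.mpr hmv
  set L : ℝ := ((m + m).factorial : ℝ) * (max 1 |ξ|) ^ m * 2 with hL
  have hLpos : 0 < L := by positivity
  set H₁ : ℝ := max H₀ 1 with hH₁
  have hH₁pos : 0 < H₁ := lt_max_of_lt_right one_pos
  obtain ⟨h₀, hh₀⟩ : ∃ h₀, ∀ h ≥ h₀, h ^ (-(w * s - m)) < L⁻¹ ∧ h ^ (-w) < H₁ ^ (-v) :=
    eventually_atTop.mp (((tendsto_rpow_neg_atTop (sub_pos.mpr hmw)).eventually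
      (gt_mem_nhds (by positivity))).and ((tendsto_rpow_neg_atTop hw0).eventually
      (gt_mem_nhds (by positivity))))
  obtain ⟨h, hhB, F, hF, hFdeg, hFh, hFw⟩ :=
    exists_irreducible_approximation hm hξ hw'0 hw'w hw' hw (max h₀ 1)
  have hh1 : 1 ≤ h := (le_max_right _ _).trans hhB
  have hhpos : 0 < h := by linarith
  obtain ⟨hsmall, hθH₁⟩ := hh₀ h ((le_max_left _ _).trans hhB)
  set θ : ℝ := |aeval ξ F| with hθ
  have hθ0 : 0 < θ := abs_pos.mpr fun h0 => hF.ne_zero (transcendental_iff.mp hξ F h0)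
  set H : ℝ := (θ / 2) ^ (-v⁻¹) with hH
  have hHv : H ^ (-v) = θ / 2 := by
    rw [hH, ← Real.rpow_mul (by positivity), neg_mul_neg, inv_mul_cancel₀ hv0.ne', Real.rpow_one]
  have hH₁H : H₁ ≤ H := by
    by_contra! hlt'
    have := Real.rpow_le_rpow_of_nonpos (z := -v) (show 0 < H by positivity) hlt'.le (by linarith)
    rw [hHv] at this
    linarith
  obtain ⟨Q, hQdeg, hQH, hQpos, hQle⟩ := hH₀ H ((le_max_left _ _).trans hH₁H)
  rw [hHv] at hQle
  have hFQ : ¬ F ∣ Q := by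
    rintro ⟨G, rfl⟩
    have hG0 : G ≠ 0 := by rintro rfl; simp at hQpos
    rw [natDegree_mul hF.ne_zero hG0] at hQdeg
    obtain ⟨g, rfl⟩ : ∃ g, G = C g := ⟨_, eq_C_of_natDegree_eq_zero (by omega)⟩
    have hg : (1 : ℝ) ≤ |(g : ℝ)| := by
      exact_mod_cast Int.one_le_abs (by rintro rfl; simp at hG0)
    rw [map_mul, abs_mul, aeval_C] at hQle
    have := le_mul_of_one_le_right hθ0.le hg
    simp only [algebraMap_int_eq, eq_intCast] at hQle
    linarith
  have key := one_le_factorial_mul_of_not_dvd ξ hm hF.prime hFdeg hQdeg hFQ hh1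
    ((le_max_right _ _).trans hH₁H) hFh hQH hθ.ge (hQle.trans (by linarith))
  have hHm : H ^ m = (θ / 2) ^ (-(m / v : ℝ)) := by
    rw [hH, ← Real.rpow_mul_natCast (by positivity)]
    ring_nf
  have hθH : θ * H ^ m ≤ 2 * h ^ (-(w * s)) := by
    have h1 : θ * H ^ m = 2 * (θ / 2) ^ s := by
      rw [hHm, hs, sub_eq_add_neg, Real.rpow_add (by positivity), Real.rpow_one]
      ring
    have h2 : (θ / 2) ^ s ≤ h ^ (-(w * s)) := by
      rw [← neg_mul, Real.rpow_mul hhpos.le]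
      exact Real.rpow_le_rpow (by positivity) (by linarith) hs0.le
    rw [h1]
    linarith
  have hexp : h ^ (-(w * s - m)) = h ^ (-(w * s)) * h ^ m := by
    rw [← Real.rpow_natCast, ← Real.rpow_add hhpos]
    ring_nf
  have : (1 : ℝ) < 1 :=
    calc (1 : ℝ) ≤ _ := key
      _ = ((m + m).factorial : ℝ) * (max 1 |ξ|) ^ m * h ^ m * (θ * H ^ m) := by ring
      _ ≤ ((m + m).factorial : ℝ) * (max 1 |ξ|) ^ m * h ^ m * (2 * h ^ (-(w * s))) := by gcongr
      _ = L * h ^ (-(w * s - m)) := by rw [hexp, hL]; ring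
      _ < L * L⁻¹ := by gcongr
      _ = 1 := mul_inv_cancel₀ hLpos.ne'
  exact lt_irrefl _ this

/-- Dirichlet's box principle: integer polynomials of small height taking a small value at `ξ`. -/
theorem exists_polyHeight_le_abs_aeval_le (ξ : ℝ) {n N : ℕ} (hn : 0 < n) (hN : 0 < N) :
    ∃ P : ℤ[X], P ≠ 0 ∧ P.natDegree ≤ n ∧ polyHeight P ≤ N ∧
      |aeval ξ P| ≤ 2 * (∑ i : Fin (n + 1), |ξ| ^ (i : ℕ)) / (N : ℝ) ^ n := by
  set S : ℝ := ∑ i : Fin (n + 1), |ξ| ^ (i : ℕ) with hS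
  have hS1 : 1 ≤ S := by
    have := Finset.single_le_sum (f := fun i : Fin (n + 1) => |ξ| ^ (i : ℕ))
      (fun i _ => by positivity) (Finset.mem_univ 0)
    simpa using this
  have hNR : (0 : ℝ) < N := by exact_mod_cast hN
  set δ : ℝ := 2 * S / (N : ℝ) ^ n with hδ
  have hδ0 : 0 < δ := by positivity
  let val : (Fin (n + 1) → Fin (N + 1)) → ℝ := fun a => ∑ i, ((a i : ℕ) : ℝ) * ξ ^ (i : ℕ)
  have hval : ∀ a, |val a| ≤ N * S := by
    intro a
    refine (Finset.abs_sum_le_sum_abs _ _).trans ?_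
    rw [hS, Finset.mul_sum]
    refine Finset.sum_le_sum fun i _ => ?_
    rw [abs_mul, abs_pow, Nat.abs_cast]
    gcongr
    exact_mod_cast Nat.lt_succ_iff.mp (a i).2
  let box : (Fin (n + 1) → Fin (N + 1)) → ℕ := fun a => ⌊(val a + N * S) / δ⌋₊
  obtain ⟨a, -, b, -, hab, hbox⟩ := Finset.exists_ne_map_eq_of_card_lt_of_maps_to
    (s := Finset.univ) (t := Finset.range (N ^ (n + 1) + 1)) (f := box)
    (by
      rw [Finset.card_range, Finset.card_univ, Fintype.card_fun, Fintype.card_fin,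
        Fintype.card_fin]
      have h1 : N ^ n < (N + 1) ^ n := Nat.pow_lt_pow_left (by omega) hn.ne'
      have h2 : 0 < N ^ n := by positivity
      rw [pow_succ, pow_succ]
      nlinarith)
    (by
      intro a _
      rw [Finset.mem_coe, Finset.mem_range, Nat.lt_succ_iff]
      refine Nat.floor_le_of_le ?_
      rw [div_le_iff₀ hδ0, hδ]
      have : ((N ^ (n + 1) : ℕ) : ℝ) * (2 * S / (N : ℝ) ^ n) = 2 * (N * S) := by
        push_cast
        field_simp
        ring
      rw [this]
      have := (abs_le.mp (hval a)).2
      linarith)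
  have hnonneg : ∀ a, 0 ≤ (val a + N * S) / δ := fun a =>
    div_nonneg (by have := (abs_le.mp (hval a)).1; linarith) hδ0.le
  have hclose : |val a - val b| ≤ δ := by
    have ha1 := Nat.floor_le (hnonneg a)
    have ha2 := Nat.lt_floor_add_one ((val a + N * S) / δ)
    have hb1 := Nat.floor_le (hnonneg b)
    have hb2 := Nat.lt_floor_add_one ((val b + N * S) / δ)
    have hfl : ⌊(val a + N * S) / δ⌋₊ = ⌊(val b + N * S) / δ⌋₊ := hbox
    rw [hfl] at ha1 ha2
    have hd : |(val a + N * S) / δ - (val b + N * S) / δ| ≤ 1 :=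
      abs_le.mpr ⟨by linarith, by linarith⟩
    rw [← sub_div, abs_div, abs_of_pos hδ0, div_le_one hδ0] at hd
    simpa using hd
  set P : ℤ[X] := ∑ i : Fin (n + 1), C (((a i : ℕ) : ℤ) - ((b i : ℕ) : ℤ)) * X ^ (i : ℕ) with hP
  have hcoeff : ∀ i : Fin (n + 1), P.coeff i = ((a i : ℕ) : ℤ) - ((b i : ℕ) : ℤ) := by
    intro i
    simp only [hP, finsetSum_coeff, coeff_C_mul, coeff_X_pow, Fin.val_inj, mul_ite, mul_one,
      mul_zero, Finset.sum_ite_eq, Finset.mem_univ, if_true]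
  have hdeg : P.natDegree ≤ n := natDegree_sum_le_of_forall_le _ _ fun i _ =>
    (natDegree_C_mul_X_pow_le _ _).trans (Nat.lt_succ_iff.mp i.2)
  refine ⟨P, ?_, hdeg, ?_, ?_⟩
  · intro h0
    refine hab (funext fun i => Fin.ext ?_)
    have := hcoeff i
    rw [h0, coeff_zero] at this
    omega
  · refine polyHeight_le hNR.le fun i => ?_
    by_cases hi : i < n + 1
    · have h1 := hcoeff ⟨i, hi⟩
      have ha := (a ⟨i, hi⟩).2
      have hb := (b ⟨i, hi⟩).2
      have h2 : |P.coeff i| ≤ (N : ℤ) := by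
        rw [abs_le]
        simp only at h1
        omega
      exact_mod_cast h2
    · rw [coeff_eq_zero_of_natDegree_lt (by omega)]
      simp
  · convert hclose using 2
    simp [hP, val, sub_mul, Finset.sum_sub_distrib]

theorem natCast_le_whExp {ξ : ℝ} (hξ : Transcendental ℤ ξ) {n : ℕ} (hn : 0 < n) :
    (n : EReal) ≤ whExp n ξ := by
  refine EReal.ge_of_forall_gt_iff_ge.mp fun w hw => ?_
  have hwn : w < n := by exact_mod_cast hw
  refine le_sSup ⟨w, rfl, ?_⟩
  set S : ℝ := ∑ i : Fin (n + 1), |ξ| ^ (i : ℕ) with hS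
  have hS0 : 0 ≤ S := Finset.sum_nonneg fun i _ => by positivity
  have hev : ∀ᶠ H : ℝ in atTop, H ^ (-((n : ℝ) - w)) < (2 * S * 2 ^ n + 1)⁻¹ :=
    (tendsto_rpow_neg_atTop (sub_pos.mpr hwn)).eventually (gt_mem_nhds (by positivity))
  filter_upwards [hev, eventually_ge_atTop 1] with H hH hH1
  have hHpos : 0 < H := by linarith
  have hN : 0 < ⌊H⌋₊ := Nat.floor_pos.mpr hH1
  obtain ⟨P, hP0, hdeg, hht, hP⟩ := exists_polyHeight_le_abs_aeval_le ξ hn hN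
  refine ⟨P, hdeg, hht.trans (Nat.floor_le hHpos.le),
    abs_pos.mpr fun h0 => hP0 (transcendental_iff.mp hξ P h0), hP.trans ?_⟩
  have hNH : H / 2 ≤ ⌊H⌋₊ := by
    have h1 := Nat.lt_floor_add_one H
    have h2 : (1 : ℝ) ≤ ⌊H⌋₊ := by exact_mod_cast hN
    linarith
  calc 2 * S / (⌊H⌋₊ : ℝ) ^ n ≤ 2 * S / (H / 2) ^ n := by gcongr
    _ = 2 * S * 2 ^ n * H ^ (-((n : ℝ) - w)) * H ^ (-w) := by
        rw [mul_assoc _ (H ^ (-((n : ℝ) - w))), ← Real.rpow_add hHpos,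
          show -((n : ℝ) - w) + -w = -n by ring, Real.rpow_neg hHpos.le, Real.rpow_natCast,
          div_pow]
        field_simp
    _ ≤ 1 * H ^ (-w) := by
        gcongr
        have h3 : (0 : ℝ) < 2 * S * 2 ^ n + 1 := by positivity
        have h4 : (2 * S * 2 ^ n + 1) * H ^ (-((n : ℝ) - w)) < 1 := by
          rwa [← lt_inv_mul_iff₀ h3, mul_one]
        have h5 : 0 < H ^ (-((n : ℝ) - w)) := by positivity
        linarith
    _ = H ^ (-w) := one_mul _

theorem wExp_mono (ξ : ℝ) : Monotone fun n : ℕ => wExp n ξ := by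
  intro m n hmn
  refine sSup_le_sSup ?_
  rintro _ ⟨w, rfl, hw⟩
  exact ⟨w, rfl, hw.mono fun P hP => ⟨hP.1.trans hmn, hP.2⟩⟩

theorem exists_whExp_le {ξ : ℝ} (hξ : Transcendental ℤ ξ)
    (hfin : ∀ n : ℕ, 1 ≤ n → wExp n ξ < ⊤)
    (hlimsup : limsup (fun n : ℕ => wExp n ξ / (n : EReal)) atTop = ⊤) {c : ℝ} (hc : 1 < c)
    (N : ℕ) : ∃ m : ℕ, N ≤ m ∧ 0 < m ∧ whExp m ξ ≤ ((c * m : ℝ) : EReal) := by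
  obtain ⟨K, hK, -⟩ := EReal.lt_iff_exists_real_btwn.mp (hfin (N + 1) (by omega))
  set s : ℝ := 1 - 1 / c with hs
  have hs0 : 0 < s := sub_pos.mpr ((div_lt_one (by linarith)).mpr hc)
  set A : ℝ := max (max K 0) (2 / s) with hA
  have hA0 : 0 ≤ A := (le_max_right _ _).trans (le_max_left _ _)
  have hfreq := frequently_lt_of_lt_limsup (b := (A : EReal))
    (u := fun n : ℕ => wExp n ξ / (n : EReal)) (f := atTop)
    (h := by rw [hlimsup]; exact EReal.coe_lt_top A)
  obtain ⟨n, hnA, hn1⟩ := (hfreq.and_eventually (eventually_ge_atTop 1)).exists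
  have hnR : (1 : ℝ) ≤ n := by exact_mod_cast hn1
  have hnA' : ((A * n : ℝ) : EReal) < wExp n ξ := by
    rw [EReal.lt_div_iff (by exact_mod_cast hn1) (EReal.natCast_ne_top n)] at hnA
    exact_mod_cast hnA
  classical
  have hex : ∃ m, wExp n ξ ≤ wExp m ξ := ⟨n, le_rfl⟩
  set m := Nat.find hex with hm
  have hmspec : wExp n ξ ≤ wExp m ξ := Nat.find_spec hex
  have hmn : m ≤ n := Nat.find_min' hex le_rfl
  have hKA : K ≤ A * n := ((le_max_left _ _).trans (le_max_left _ _)).trans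
    (le_mul_of_one_le_right hA0 hnR)
  have hNm : N + 1 < m := by
    by_contra! hle
    have h1 := hmspec.trans (wExp_mono ξ hle)
    exact absurd (hK.trans_le (EReal.coe_le_coe_iff.mpr hKA))
      (not_lt.mpr (hnA'.le.trans h1))
  have hpred : wExp (m - 1) ξ < wExp n ξ :=
    not_le.mp (Nat.find_min hex (show m - 1 < m by omega))
  obtain ⟨w', hw'1, hw'2⟩ := EReal.lt_iff_exists_real_btwn.mp (max_lt hpred hnA')
  obtain ⟨w, hw1, hw2⟩ := EReal.lt_iff_exists_real_btwn.mp hw'2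
  have hAw' : A * n < w' := EReal.coe_lt_coe_iff.mp ((le_max_right _ _).trans_lt hw'1)
  have hww : w' < w := EReal.coe_lt_coe_iff.mp hw1
  have hw'0 : 0 < w' := lt_of_le_of_lt (by positivity) hAw'
  have hm0 : (0 : ℝ) < m := by exact_mod_cast (by omega : 0 < m)
  have hmnR : (m : ℝ) ≤ n := by exact_mod_cast hmn
  refine ⟨m, by omega, by omega, whExp_le_of_lt_wExp (by omega) hξ hw'0 hww
    ((le_max_left _ _).trans_lt hw'1) (hw2.trans_le hmspec) (by nlinarith) ?_⟩
  have h1 : (m : ℝ) / (c * m) = 1 / c := by field_simp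
  rw [h1, ← hs]
  have h2 : 2 ≤ A * s := (div_le_iff₀ hs0).mp (le_max_right _ _)
  have h3 : A * n * s < w * s := mul_lt_mul_of_pos_right (hAw'.trans hww) hs0
  nlinarith

theorem stmt11 (ξ : ℝ) (hξ : Transcendental ℚ ξ)
    (hT1 : ∀ n : ℕ, 1 ≤ n → wExp n ξ < ⊤)
    (hT2 : Filter.limsup (fun n : ℕ => wExp n ξ / (n : EReal)) Filter.atTop = ⊤) :
    Filter.liminf (fun n : ℕ => whExp n ξ / (n : EReal)) Filter.atTop = 1 := by
  have hξ' : Transcendental ℤ ξ := fun h =>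
    hξ (IsAlgebraic.extendScalars (RingHom.injective_int _) h)
  refine le_antisymm ?_ ?_
  · refine EReal.le_of_forall_lt_iff_le.mp fun c hc => ?_
    have hc1 : 1 < c := by exact_mod_cast hc
    refine liminf_le_of_frequently_le' (frequently_atTop.mpr fun N => ?_)
    obtain ⟨m, hNm, hm, hle⟩ := exists_whExp_le hξ' hT1 hT2 hc1 N
    refine ⟨m, hNm, ?_⟩
    rw [EReal.div_le_iff_le_mul (by exact_mod_cast hm) (EReal.natCast_ne_top m), mul_comm]
    exact_mod_cast hle
  · refine le_liminf_of_le (by isBoundedDefault) ((eventually_gt_atTop 0).mono fun n hn => ?_)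
    rw [EReal.le_div_iff_mul_le (by exact_mod_cast hn) (EReal.natCast_ne_top n), one_mul]
    exact natCast_le_whExp hξ' hn
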